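/- Let ι be a finite type, S : ι → Type a family of state spaces, and prec a relation on ι whose transitive closure is irreflexive (so the same holds for its converse). Let u¹, u², u³, u⁴, u⁵ be five families of update functions such that u¹ and u⁵ are local with respect to the converse of prec, and u², u³, u⁴ are local with respect to prec. For k = 1,…,5 let ℓₖ and ℓₖ' be topological sorts of the relevant relation (the converse of prec for k ∈ {1,5}, and prec for k ∈ {2,3,4}). Then for every initial global state x₀, the composite of the five full passes performed in order along ℓ₁,…,ℓ₅ from x₀ equals the composite of the five full passes performed in order along ℓ₁',…,ℓ₅' from x₀. Hence the five-stage process update is well-defined: its output is uniquely determined by the initial state, independent of all choices of node orderings. -/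

import Mathlib

/-- A family of update functions is local w.r.t. a relation `r`: the update of
node `i` depends only on the components `x j` with `r j i`. -/
def IsLocal {ι : Type*} {S : ι → Type*} (r : ι → ι → Prop)
    (u : ∀ i, (∀ j, S j) → S i) : Prop :=
  ∀ i (x y : ∀ j, S j), (∀ j, r j i → x j = y j) → u i x = u i y

/-- The step function (for the family `u`) of node `i`. -/
def step {ι : Type*} [DecidableEq ι] {S : ι → Type*}
    (u : ∀ i, (∀ j, S j) → S i) (i : ι) (x : ∀ j, S j) : ∀ j, S j :=
  Function.update x i (u i x)

/-- A list `ℓ` is a topological sort of a relation `r`: it contains every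
element of `ι` exactly once, and whenever the transitive closure of `r`
relates `a` to `b`, `a` occurs before `b` in `ℓ`. -/
def IsTopoSort {ι : Type*} [Fintype ι] [DecidableEq ι]
    (r : ι → ι → Prop) (ℓ : List ι) : Prop :=
  (∀ i : ι, ℓ.count i = 1) ∧
  ∀ a b : ι, Relation.TransGen r a b → [a, b].Sublist ℓ

/-- A full pass for the family `u` along the list `ℓ` from initial state `x`. -/
def pass {ι : Type*} [DecidableEq ι] {S : ι → Type*}
    (u : ∀ i, (∀ j, S j) → S i) (ℓ : List ι) (x : ∀ j, S j) : ∀ j, S j :=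
  List.foldl (fun x i => step u i x) x ℓ

theorem pass_append {ι : Type*} [DecidableEq ι] {S : ι → Type*}
    (u : ∀ i, (∀ j, S j) → S i) (l₁ l₂ : List ι) (x : ∀ j, S j) :
    pass u (l₁ ++ l₂) x = pass u l₂ (pass u l₁ x) :=
  List.foldl_append

theorem pass_cons {ι : Type*} [DecidableEq ι] {S : ι → Type*}
    (u : ∀ i, (∀ j, S j) → S i) (i : ι) (l : List ι) (x : ∀ j, S j) :
    pass u (i :: l) x = pass u l (step u i x) :=
  rfl

theorem pass_apply_of_notMem {ι : Type*} [DecidableEq ι] {S : ι → Type*}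
    (u : ∀ i, (∀ j, S j) → S i) {l : List ι} {j : ι} (hj : j ∉ l) (x : ∀ j, S j) :
    pass u l x j = x j := by
  induction l generalizing x with
  | nil => rfl
  | cons i l ih =>
    rw [List.mem_cons, not_or] at hj
    rw [pass_cons, ih hj.2, step, Function.update_of_ne hj.1]

theorem List.Nodup.notMem_of_pair_sublist {α : Type*} {l₁ l₂ : List α} {a b : α}
    (hnd : (l₁ ++ b :: l₂).Nodup) (hs : [a, b].Sublist (l₁ ++ b :: l₂)) :
    a ∉ b :: l₂ := by
  have hb₁ : b ∉ l₁ := fun h => List.disjoint_of_nodup_append hnd h List.mem_cons_self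
  have hb₂ : b ∉ l₂ := (List.nodup_cons.1 hnd.of_append_right).1
  suffices ha : a ∈ l₁ from List.disjoint_of_nodup_append hnd ha
  obtain ⟨s, t, hst, hs, ht⟩ := List.sublist_append_iff.1 hs
  match s, hst with
  | [], hst =>
    obtain rfl : [a, b] = t := hst
    cases ht with
    | cons _ h => exact absurd (h.subset (by simp)) hb₂
    | cons_cons _ h => exact absurd (h.subset (by simp)) hb₂
  | c :: s, hst =>
    obtain rfl : a = c := (List.cons.inj hst).1
    exact hs.subset List.mem_cons_self

theorem IsTopoSort.nodup {ι : Type*} [Fintype ι] [DecidableEq ι] {r : ι → ι → Prop}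
    {l : List ι} (hl : IsTopoSort r l) : l.Nodup :=
  List.nodup_iff_count_le_one.2 fun i => (hl.1 i).le

theorem IsTopoSort.mem {ι : Type*} [Fintype ι] [DecidableEq ι] {r : ι → ι → Prop}
    {l : List ι} (hl : IsTopoSort r l) (i : ι) : i ∈ l :=
  List.count_pos_iff.1 ((hl.1 i).symm ▸ Nat.one_pos)

theorem IsTopoSort.irrefl_transGen {ι : Type*} [Fintype ι] [DecidableEq ι]
    {r : ι → ι → Prop} {l : List ι} (hl : IsTopoSort r l) (i : ι) :
    ¬ Relation.TransGen r i i := fun h => by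
  simpa using (hl.2 i i h).nodup hl.nodup

theorem IsTopoSort.wellFounded {ι : Type*} [Fintype ι] [DecidableEq ι]
    {r : ι → ι → Prop} {l : List ι} (hl : IsTopoSort r l) : WellFounded r :=
  have : Std.Irrefl (Relation.TransGen r) := ⟨hl.irrefl_transGen⟩
  Subrelation.wf Relation.TransGen.single
    (Finite.wellFounded_of_trans_of_irrefl (Relation.TransGen r))

/-- A full pass along a topological sort ends in a state that every node's update fixes. -/
theorem IsLocal.pass_apply {ι : Type*} [Fintype ι] [DecidableEq ι] {S : ι → Type*}
    {r : ι → ι → Prop} {u : ∀ i, (∀ j, S j) → S i} (hu : IsLocal r u)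
    {l : List ι} (hl : IsTopoSort r l) (x : ∀ j, S j) (i : ι) :
    pass u l x i = u i (pass u l x) := by
  obtain ⟨l₁, l₂, rfl⟩ := List.append_of_mem (hl.mem i)
  have hi : i ∉ l₂ := (List.nodup_cons.1 hl.nodup.of_append_right).1
  calc pass u (l₁ ++ i :: l₂) x i
      = u i (pass u l₁ x) := by
        rw [pass_append, pass_cons, pass_apply_of_notMem u hi, step, Function.update_self]
    _ = u i (pass u (l₁ ++ i :: l₂) x) := hu i _ _ fun j hj => by
        rw [pass_append, pass_apply_of_notMem u
          (hl.nodup.notMem_of_pair_sublist (hl.2 j i (.single hj)))]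

theorem IsLocal.eq_of_fixed {ι : Type*} {S : ι → Type*} {r : ι → ι → Prop}
    {u : ∀ i, (∀ j, S j) → S i} (hu : IsLocal r u) (hr : WellFounded r)
    {x y : ∀ j, S j} (hx : ∀ i, x i = u i x) (hy : ∀ i, y i = u i y) : x = y :=
  funext fun i => hr.induction (C := fun i => x i = y i) i fun i ih => by
    rw [hx i, hy i]
    exact hu i x y ih

/-- The result of a full pass does not depend on the topological sort. -/
theorem IsLocal.pass_eq_pass {ι : Type*} [Fintype ι] [DecidableEq ι] {S : ι → Type*}
    {r : ι → ι → Prop} {u : ∀ i, (∀ j, S j) → S i} (hu : IsLocal r u)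
    {l l' : List ι} (hl : IsTopoSort r l) (hl' : IsTopoSort r l') (x : ∀ j, S j) :
    pass u l x = pass u l' x :=
  hu.eq_of_fixed hl.wellFounded (hu.pass_apply hl x) (hu.pass_apply hl' x)

/-- The five-stage process update (downward, upward, upward, upward, downward
passes) is well-defined: its output is determined by the initial state,
independently of the chosen topological sorts. -/
theorem five_stage_process_welldefined {ι : Type*} [Fintype ι] [DecidableEq ι]
    {S : ι → Type*} (prec : ι → ι → Prop)
    (hdag : Irreflexive (Relation.TransGen prec))
    (u₁ u₂ u₃ u₄ u₅ : ∀ i, (∀ j, S j) → S i)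
    (h₁ : IsLocal (Function.swap prec) u₁)
    (h₂ : IsLocal prec u₂) (h₃ : IsLocal prec u₃) (h₄ : IsLocal prec u₄)
    (h₅ : IsLocal (Function.swap prec) u₅)
    (ℓ₁ ℓ₂ ℓ₃ ℓ₄ ℓ₅ ℓ₁' ℓ₂' ℓ₃' ℓ₄' ℓ₅' : List ι)
    (hℓ₁ : IsTopoSort (Function.swap prec) ℓ₁)
    (hℓ₂ : IsTopoSort prec ℓ₂) (hℓ₃ : IsTopoSort prec ℓ₃)
    (hℓ₄ : IsTopoSort prec ℓ₄)
    (hℓ₅ : IsTopoSort (Function.swap prec) ℓ₅)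
    (hℓ₁' : IsTopoSort (Function.swap prec) ℓ₁')
    (hℓ₂' : IsTopoSort prec ℓ₂') (hℓ₃' : IsTopoSort prec ℓ₃')
    (hℓ₄' : IsTopoSort prec ℓ₄')
    (hℓ₅' : IsTopoSort (Function.swap prec) ℓ₅')
    (x₀ : ∀ j, S j) :
    pass u₅ ℓ₅ (pass u₄ ℓ₄ (pass u₃ ℓ₃ (pass u₂ ℓ₂ (pass u₁ ℓ₁ x₀)))) =
      pass u₅ ℓ₅' (pass u₄ ℓ₄' (pass u₃ ℓ₃' (pass u₂ ℓ₂' (pass u₁ ℓ₁' x₀)))) := by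
  rw [h₁.pass_eq_pass hℓ₁ hℓ₁', h₂.pass_eq_pass hℓ₂ hℓ₂', h₃.pass_eq_pass hℓ₃ hℓ₃',
    h₄.pass_eq_pass hℓ₄ hℓ₄', h₅.pass_eq_pass hℓ₅ hℓ₅']
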